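/- arXiv:1210.8090 — 5 statements merged into one kernel-verified Lean document; each statement's English description precedes it below -/
import Mathlib

section
/- Let 0 ≤ k ≤ k' be integers and let f : ℕ → ℂ be finitely supported. Then for all real t > 0, Σ_{n∈ℕ} f(n) ℒ_n^{(k)}(t) = Σ_{n∈ℕ} ((1+τ)^{k'-k} f)(n) ℒ_n^{(k')}(t), where (1+τ)^m f(n) = Σ_{j=0}^{m} binom(m,j) f(n+j). -/
/-- The generalized Laguerre polynomial of type `k`:
`L_n^{(k)}(u) = (u^{-k} e^u / n!) (d/du)^n (u^{k+n} e^{-u})`. -/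
noncomputable def lagP (n k : ℕ) (u : ℝ) : ℝ :=
  Real.exp u / (n.factorial * u ^ k) *
    iteratedDeriv n (fun v : ℝ => v ^ (k + n) * Real.exp (-v)) u

/-- The Laguerre function `ℒ_n^{(k)}(t) = 2 (-1)^n e^{-t} L_n^{(k)}(2t)`. -/
noncomputable def lagF (n k : ℕ) (t : ℝ) : ℝ :=
  2 * (-1 : ℝ) ^ n * Real.exp (-t) * lagP n k (2 * t)

theorem iteratedDeriv_succ_id_mul {g : ℝ → ℝ} (hg : ContDiff ℝ ⊤ g) (n : ℕ) :
    iteratedDeriv (n + 1) (fun v => v * g v) =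
      fun v => v * iteratedDeriv (n + 1) g v + (n + 1) * iteratedDeriv n g v := by
  have hd (m : ℕ) : Differentiable ℝ (iteratedDeriv m g) :=
    hg.differentiable_iteratedDeriv m (WithTop.coe_lt_top _)
  induction n with
  | zero =>
    ext v
    have h := (hasDerivAt_id v).mul (hd 0 v).hasDerivAt
    simp only [iteratedDeriv_zero] at h
    have h' : deriv (fun v => v * g v) v = 1 * g v + v * deriv g v := h.deriv
    simp [iteratedDeriv_one, h', add_comm]
  | succ n ih =>
    ext v
    rw [iteratedDeriv_succ, ih]
    have h := ((hasDerivAt_id v).mul (hd (n + 1) v).hasDerivAt).add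
      ((hd n v).hasDerivAt.const_mul ((n : ℝ) + 1))
    refine h.deriv.trans ?_
    rw [← iteratedDeriv_succ, ← iteratedDeriv_succ]
    push_cast
    simp only [id]
    ring

theorem lagP_zero {u : ℝ} (hu : u ≠ 0) (k : ℕ) : lagP 0 k u = 1 := by
  have : Real.exp u ≠ 0 := Real.exp_ne_zero u
  simp only [lagP, iteratedDeriv_zero, Real.exp_neg]
  field_simp
  simp

theorem lagP_succ_type {u : ℝ} (hu : u ≠ 0) (n k : ℕ) :
    lagP (n + 1) (k + 1) u = lagP (n + 1) k u + lagP n (k + 1) u := by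
  have hg : ContDiff ℝ ⊤ (fun v : ℝ => v ^ (k + (n + 1)) * Real.exp (-v)) := by fun_prop
  have h := congrFun (iteratedDeriv_succ_id_mul hg n) u
  have e : (fun v : ℝ => v * (v ^ (k + (n + 1)) * Real.exp (-v))) =
      fun v => v ^ (k + 1 + (n + 1)) * Real.exp (-v) := by
    ext v
    ring
  have e' : k + 1 + n = k + (n + 1) := by ring
  rw [e] at h
  have hn : (n.factorial : ℝ) ≠ 0 := by positivity
  have hn' : (n : ℝ) + 1 ≠ 0 := by positivity
  simp only [lagP, h, e', Nat.factorial_succ]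
  push_cast
  field_simp
  ring

theorem lagF_zero_type {t : ℝ} (ht : t ≠ 0) (k l : ℕ) : lagF 0 k t = lagF 0 l t := by
  simp [lagF, lagP_zero (mul_ne_zero two_ne_zero ht)]

theorem lagF_succ_type {t : ℝ} (ht : t ≠ 0) (n k : ℕ) :
    lagF (n + 1) k t = lagF (n + 1) (k + 1) t + lagF n (k + 1) t := by
  simp only [lagF, lagP_succ_type (mul_ne_zero two_ne_zero ht)]
  ring

theorem finite_support_comp_add_right {f : ℕ → ℂ} (hf : (Function.support f).Finite) (j : ℕ) :
    (Function.support fun n => f (n + j)).Finite :=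
  hf.preimage (add_left_injective j).injOn

theorem summable_mul_of_finite_support {f : ℕ → ℂ} (hf : (Function.support f).Finite)
    (c : ℕ → ℂ) : Summable fun n => f n * c n :=
  summable_of_hasFiniteSupport (hf.subset (Function.support_mul_subset_left f c))

theorem tsum_mul_lagF_succ_type {f : ℕ → ℂ} (hf : (Function.support f).Finite) {t : ℝ}
    (ht : t ≠ 0) (k : ℕ) :
    ∑' n : ℕ, f n * (lagF n k t : ℂ) =
      ∑' n : ℕ, (f n + f (n + 1)) * (lagF n (k + 1) t : ℂ) := by
  have hf' := finite_support_comp_add_right hf 1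
  simp only [add_mul]
  rw [(summable_mul_of_finite_support hf _).tsum_add (summable_mul_of_finite_support hf' _),
    (summable_mul_of_finite_support hf _).tsum_eq_zero_add,
    (summable_mul_of_finite_support hf fun n => (lagF n (k + 1) t : ℂ)).tsum_eq_zero_add,
    lagF_zero_type ht k (k + 1), add_assoc,
    ← (summable_mul_of_finite_support hf' _).tsum_add (summable_mul_of_finite_support hf' _)]
  simp only [lagF_succ_type ht _ k, Complex.ofReal_add, mul_add]

theorem sum_range_choose_succ_mul (f : ℕ → ℂ) (m n : ℕ) :
    ∑ j ∈ Finset.range (m + 1 + 1), ((m + 1).choose j : ℂ) * f (n + j) =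
      ∑ j ∈ Finset.range (m + 1), (m.choose j : ℂ) * (f (n + j) + f (n + j + 1)) := by
  simp only [mul_add, Finset.sum_add_distrib]
  exact (Finset.sum_choose_succ_mul (fun i _ => f (n + i)) m).trans (by simp [add_assoc])

theorem tsum_mul_lagF_add_type {t : ℝ} (ht : t ≠ 0) (m k : ℕ) {f : ℕ → ℂ}
    (hf : (Function.support f).Finite) :
    ∑' n : ℕ, f n * (lagF n k t : ℂ) =
      ∑' n : ℕ, (∑ j ∈ Finset.range (m + 1), (m.choose j : ℂ) * f (n + j))
        * (lagF n (k + m) t : ℂ) := by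
  induction m generalizing k f with
  | zero => simp
  | succ m ih =>
    have hf' : (Function.support fun n => f n + f (n + 1)).Finite :=
      (hf.union (finite_support_comp_add_right hf 1)).subset (Function.support_add _ _)
    rw [tsum_mul_lagF_succ_type hf ht, ih (k + 1) hf']
    simp only [sum_range_choose_succ_mul, add_right_comm k 1 m, ← add_assoc]

/-- For finitely supported `f : ℕ → ℂ`, `k ≤ k'` and `t > 0`,
`Σ_n f(n) ℒ_n^{(k)}(t) = Σ_n ((1+τ)^{k'-k} f)(n) ℒ_n^{(k')}(t)`, where
`(1+τ)^m f(n) = Σ_{j=0}^{m} binom(m,j) f(n+j)`. -/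
theorem laguerre_type_raise_iter (k k' : ℕ) (hkk' : k ≤ k')
    (f : ℕ → ℂ) (hf : (Function.support f).Finite) (t : ℝ) (ht : 0 < t) :
    ∑' n : ℕ, f n * (lagF n k t : ℂ)
      = ∑' n : ℕ, (∑ j ∈ Finset.range (k' - k + 1), ((k' - k).choose j : ℂ) * f (n + j))
          * (lagF n k' t : ℂ) := by
  have h := tsum_mul_lagF_add_type ht.ne' (k' - k) k hf
  rwa [Nat.add_sub_cancel' hkk'] at h
end

section
/- Let k ∈ ℕ and let f : ℝ → ℂ be k times continuously differentiable. Then for every n ∈ ℕ, |δ^k f(n)|² ≤ ∫_{[0,1]^k} |f^{(k)}(n + s₁ + ⋯ + s_k)|² ds₁ ⋯ ds_k, where δ^k denotes the k-th iterate of the operator δg(n) = g(n+1) - g(n) applied to the restriction of f to ℕ. -/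
open MeasureTheory

/-- The difference operator `δg(n) = g(n+1) - g(n)` on functions `ℕ → ℂ`. -/
def deltaOp (g : ℕ → ℂ) : ℕ → ℂ := fun n => g (n + 1) - g n

theorem deltaOp_iterate_natCast (k : ℕ) (f : ℝ → ℂ) (n : ℕ) :
    deltaOp^[k] (fun m : ℕ => f m) n = (fwdDiff (1 : ℝ))^[k] f n := by
  induction k generalizing f with
  | zero => rfl
  | succ k ih =>
    rw [Function.iterate_succ_apply, Function.iterate_succ_apply, ← ih]
    have h : deltaOp (fun m : ℕ => f m) = fun m : ℕ => fwdDiff (1 : ℝ) f m := by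
      ext m
      simp [deltaOp, fwdDiff]
    rw [h]

theorem iteratedDeriv_fwdDiff {E : Type*} [NormedAddCommGroup E] [NormedSpace ℝ E]
    {k : ℕ} {f : ℝ → E} (hf : ContDiff ℝ k f) (h x : ℝ) :
    iteratedDeriv k (fwdDiff h f) x = iteratedDeriv k f (x + h) - iteratedDeriv k f x := by
  have hc : ContDiff ℝ k fun y => f (y + h) := hf.comp (contDiff_id.add contDiff_const)
  change iteratedDeriv k (fun y => f (y + h) - f y) x = _
  rw [iteratedDeriv_fun_sub hc.contDiffAt hf.contDiffAt, iteratedDeriv_comp_add_const]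

theorem Continuous.integrable_pi_Icc {E : Type*} [NormedAddCommGroup E]
    {ι : Type*} [Fintype ι] {g : (ι → ℝ) → E} (hg : Continuous g) (a b : ℝ) :
    Integrable g (Measure.pi fun _ => (volume : Measure ℝ).restrict (Set.Icc a b)) := by
  rw [← Measure.restrict_pi_pi]
  exact hg.continuousOn.integrableOn_compact (isCompact_univ_pi fun _ => isCompact_Icc)

/-- An iterated forward difference is an average of the iterated derivative over the unit cube. -/
theorem fwdDiff_iterate_eq_integral {E : Type*} [NormedAddCommGroup E] [NormedSpace ℝ E]
    [CompleteSpace E] (k : ℕ) {f : ℝ → E} (hf : ContDiff ℝ k f) (x : ℝ) :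
    (fwdDiff (1 : ℝ))^[k] f x = ∫ s : Fin k → ℝ, iteratedDeriv k f (x + ∑ i, s i)
      ∂Measure.pi fun _ => (volume : Measure ℝ).restrict (Set.Icc 0 1) := by
  induction k generalizing f with
  | zero => simp [measureReal_def]
  | succ k ih =>
    have hfk : ContDiff ℝ k f := hf.of_le (by exact_mod_cast k.le_succ)
    have hΔ : ContDiff ℝ k (fwdDiff (1 : ℝ) f) :=
      (hfk.comp (contDiff_id.add contDiff_const)).sub hfk
    have hcont : Continuous (iteratedDeriv (k + 1) f) := hf.continuous_iteratedDeriv _ le_rfl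
    have hderiv (y : ℝ) : HasDerivAt (iteratedDeriv k f) (iteratedDeriv (k + 1) f y) y := by
      rw [iteratedDeriv_succ]
      exact (hf.differentiable_iteratedDeriv k (by exact_mod_cast k.lt_succ_self) y).hasDerivAt
    have hinner (y : ℝ) : iteratedDeriv k (fwdDiff (1 : ℝ) f) y =
        ∫ t in Set.Icc (0 : ℝ) 1, iteratedDeriv (k + 1) f (y + t) := by
      rw [iteratedDeriv_fwdDiff hfk, integral_Icc_eq_integral_Ioc,
        ← intervalIntegral.integral_of_le zero_le_one, intervalIntegral.integral_comp_add_left,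
        intervalIntegral.integral_eq_sub_of_hasDerivAt (fun z _ => hderiv z)
          (hcont.intervalIntegrable _ _), add_zero]
    have hmp := (measurePreserving_piFinSuccAbove
      (fun _ : Fin (k + 1) => (volume : Measure ℝ).restrict (Set.Icc 0 1)) 0).symm
    have hgi : Integrable (fun s : Fin (k + 1) → ℝ => iteratedDeriv (k + 1) f (x + ∑ i, s i))
        (Measure.pi fun _ => (volume : Measure ℝ).restrict (Set.Icc 0 1)) :=
      Continuous.integrable_pi_Icc (by fun_prop) 0 1
    rw [Function.iterate_succ_apply, ih hΔ, ← hmp.integral_comp', integral_prod_symm]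
    · refine integral_congr_ae (.of_forall fun s => ?_)
      simp only [hinner]
      refine integral_congr_ae (.of_forall fun t => ?_)
      simp [MeasurableEquiv.piFinSuccAbove_symm_apply, Fin.sum_univ_succ, add_left_comm, add_comm]
    · exact hmp.integrable_comp_of_integrable hgi

/-- For `f : ℝ → ℂ` of class `C^k` and `n ∈ ℕ`,
`|δ^k f(n)|² ≤ ∫_{[0,1]^k} |f^{(k)}(n + s₁ + ⋯ + s_k)|² ds`. -/
theorem finite_difference_sq_bound (k : ℕ) (f : ℝ → ℂ) (hf : ContDiff ℝ k f) (n : ℕ) :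
    ‖deltaOp^[k] (fun m : ℕ => f m) n‖ ^ 2
      ≤ ∫ s : Fin k → ℝ in Set.univ.pi fun _ => Set.Icc (0 : ℝ) 1,
          ‖iteratedDeriv k f (n + ∑ i, s i)‖ ^ 2 := by
  have hcont : Continuous (iteratedDeriv k f) := hf.continuous_iteratedDeriv _ le_rfl
  have : IsProbabilityMeasure ((volume : Measure ℝ).restrict (Set.Icc 0 1)) := ⟨by simp⟩
  rw [deltaOp_iterate_natCast, fwdDiff_iterate_eq_integral k hf, volume_pi,
    Measure.restrict_pi_pi]
  exact (convexOn_univ_norm.pow (fun _ _ => norm_nonneg _) 2).map_integral_le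
    (by fun_prop) isClosed_univ (by simp)
    (Continuous.integrable_pi_Icc (by fun_prop) 0 1)
    (Continuous.integrable_pi_Icc (by simp only [Function.comp_def, Pi.pow_apply]; fun_prop) 0 1)
end

section
/- Let λ > 0 and μ ∈ ℝ. For each (x,y) ∈ ℝ³ × ℝ³ there is a unitary operator π_{λ,μ}(x,y) on L²(ℝ, ℂ) given for a.e. u ∈ ℝ by (π_{λ,μ}(x,y)φ)(u) = e^{iλ y₃} e^{iλ(u + x₁/2) x₂} e^{iμ x₃} φ(x₁ + u), and the map π_{λ,μ} is a group homomorphism: π_{λ,μ}(x,y) ∘ π_{λ,μ}(x',y') = π_{λ,μ}((x,y)·(x',y')) for all (x,y), (x',y') ∈ ℝ³ × ℝ³, where the group law is (x,y)·(x',y') = (x + x', y + y' + x ∧ x'/2) and x ∧ x' denotes the vector cross product in ℝ³. -/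
open MeasureTheory

/-- The group law of `N_{3,2}` in exponential coordinates:
`(x,y)·(x',y') = (x + x', y + y' + x ∧ x'/2)`, with `∧` the cross product in `ℝ³`. -/
noncomputable def n32mul (p q : (Fin 3 → ℝ) × (Fin 3 → ℝ)) : (Fin 3 → ℝ) × (Fin 3 → ℝ) :=
  (p.1 + q.1, p.2 + q.2 + (1 / 2 : ℝ) • crossProduct p.1 q.1)

theorem eLpNorm_circle_mul_translate (c : C(ℝ, Circle)) (a : ℝ)
    (φ : Lp ℂ 2 (volume : Measure ℝ)) :
    eLpNorm (fun u => (c u : ℂ) * φ (a + u)) 2 volume = eLpNorm φ 2 volume := by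
  rw [← eLpNorm_comp_measurePreserving (Lp.aestronglyMeasurable φ)
    (measurePreserving_add_left volume a)]
  exact eLpNorm_congr_norm_ae (.of_forall fun u => by simp [Circle.norm_coe])

theorem memLp_circle_mul_translate (c : C(ℝ, Circle)) (a : ℝ)
    (φ : Lp ℂ 2 (volume : Measure ℝ)) :
    MemLp (fun u => (c u : ℂ) * φ (a + u)) 2 volume :=
  ⟨(show Continuous fun u => (c u : ℂ) by fun_prop).aestronglyMeasurable.mul
      ((Lp.aestronglyMeasurable φ).comp_measurePreserving (measurePreserving_add_left volume a)),
    (eLpNorm_circle_mul_translate c a φ).trans_lt (Lp.eLpNorm_lt_top φ)⟩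

/-- Translation by `a` followed by multiplication by the unimodular function `c`, as a linear
isometry of `L²(ℝ, ℂ)`. -/
noncomputable def weightedTranslation (c : C(ℝ, Circle)) (a : ℝ) :
    Lp ℂ 2 (volume : Measure ℝ) →ₗᵢ[ℂ] Lp ℂ 2 (volume : Measure ℝ) where
  toFun φ := (memLp_circle_mul_translate c a φ).toLp
  map_add' φ ψ := by
    rw [← MemLp.toLp_add, MemLp.toLp_eq_toLp_iff]
    filter_upwards [(measurePreserving_add_left volume a).quasiMeasurePreserving.ae
      (Lp.coeFn_add φ ψ)] with u hu
    simp only [hu, Pi.add_apply, mul_add]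
  map_smul' z φ := by
    rw [RingHom.id_apply, ← MemLp.toLp_const_smul, MemLp.toLp_eq_toLp_iff]
    filter_upwards [(measurePreserving_add_left volume a).quasiMeasurePreserving.ae
      (Lp.coeFn_smul z φ)] with u hu
    simp only [hu, Pi.smul_apply, smul_eq_mul, mul_left_comm]
  norm_map' φ := by
    change ‖(memLp_circle_mul_translate c a φ).toLp‖ = ‖φ‖
    rw [Lp.norm_toLp, eLpNorm_circle_mul_translate, Lp.norm_def]

theorem coeFn_weightedTranslation (c : C(ℝ, Circle)) (a : ℝ)
    (φ : Lp ℂ 2 (volume : Measure ℝ)) :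
    weightedTranslation c a φ =ᵐ[volume] fun u => (c u : ℂ) * φ (a + u) :=
  (memLp_circle_mul_translate c a φ).coeFn_toLp

theorem weightedTranslation_comp {c c' d : C(ℝ, Circle)} {a a' b : ℝ}
    (hd : ∀ u, c u * c' (a + u) = d u) (hb : a + a' = b) (φ : Lp ℂ 2 (volume : Measure ℝ)) :
    weightedTranslation c a (weightedTranslation c' a' φ) = weightedTranslation d b φ := by
  apply Lp.ext
  filter_upwards [coeFn_weightedTranslation c a (weightedTranslation c' a' φ),
    coeFn_weightedTranslation d b φ,
    (measurePreserving_add_left volume a).quasiMeasurePreserving.ae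
      (coeFn_weightedTranslation c' a' φ)] with u h₁ h₂ h₃
  rw [h₁, h₂, h₃, ← hd, ← hb, Circle.coe_mul, mul_assoc, ← add_assoc, add_comm a' a]

theorem weightedTranslation_one_zero (φ : Lp ℂ 2 (volume : Measure ℝ)) :
    weightedTranslation 1 0 φ = φ := by
  apply Lp.ext
  filter_upwards [coeFn_weightedTranslation 1 0 φ] with u hu
  simp [hu]

theorem weightedTranslation_surjective (c : C(ℝ, Circle)) (a : ℝ) :
    Function.Surjective (weightedTranslation c a) := fun φ =>
  ⟨weightedTranslation (c⁻¹.comp ⟨fun u => u - a, by fun_prop⟩) (-a) φ, by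
    rw [weightedTranslation_comp (d := 1) (b := 0) (by simp) (by simp),
      weightedTranslation_one_zero]⟩

/-- The unimodular multiplier of the Schrödinger representation of `N_{3,2}`. -/
noncomputable def schroedingerPhase (lam mu : ℝ) (p : (Fin 3 → ℝ) × (Fin 3 → ℝ)) :
    C(ℝ, Circle) where
  toFun u := Circle.exp (lam * p.2 2 + lam * (u + p.1 0 / 2) * p.1 1 + mu * p.1 2)
  continuous_toFun := by fun_prop

theorem schroedingerPhase_mul (lam mu : ℝ) (p q : (Fin 3 → ℝ) × (Fin 3 → ℝ)) (u : ℝ) :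
    schroedingerPhase lam mu p u * schroedingerPhase lam mu q (p.1 0 + u) =
      schroedingerPhase lam mu (n32mul p q) u := by
  simp only [schroedingerPhase, ContinuousMap.coe_mk, ← Circle.exp_add]
  congr 1
  simp only [n32mul, cross_apply, Pi.add_apply, Pi.smul_apply, smul_eq_mul, Matrix.cons_val]
  ring

/-- For `λ > 0`, `μ ∈ ℝ`, there is a family of unitary operators `π_{λ,μ}(x,y)` on
`L²(ℝ, ℂ)` given by `(π_{λ,μ}(x,y)φ)(u) = e^{iλy₃} e^{iλ(u+x₁/2)x₂} e^{iμx₃} φ(x₁+u)`,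
which is a group homomorphism for the `N_{3,2}` group law. -/
theorem schroedinger_representation (lam : ℝ) (hlam : 0 < lam) (mu : ℝ) :
    ∃ π : (Fin 3 → ℝ) × (Fin 3 → ℝ) →
        (Lp ℂ 2 (volume : Measure ℝ) ≃ₗᵢ[ℂ] Lp ℂ 2 (volume : Measure ℝ)),
      (∀ (x y : Fin 3 → ℝ) (φ : Lp ℂ 2 (volume : Measure ℝ)),
        (π (x, y) φ : ℝ → ℂ) =ᵐ[volume] fun u =>
          Complex.exp (Complex.I * lam * y 2)
            * Complex.exp (Complex.I * lam * (u + x 0 / 2) * x 1)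
            * Complex.exp (Complex.I * mu * x 2)
            * (φ : ℝ → ℂ) (x 0 + u)) ∧
      (∀ p q : (Fin 3 → ℝ) × (Fin 3 → ℝ), ∀ φ : Lp ℂ 2 (volume : Measure ℝ),
        π p (π q φ) = π (n32mul p q) φ) := by
  refine ⟨fun p => .ofSurjective (weightedTranslation (schroedingerPhase lam mu p) (p.1 0))
    (weightedTranslation_surjective _ _), fun x y φ => ?_, fun p q φ => ?_⟩
  · filter_upwards [coeFn_weightedTranslation (schroedingerPhase lam mu (x, y)) (x 0) φ] with u hu
    rw [LinearIsometryEquiv.coe_ofSurjective, hu, ← Complex.exp_add, ← Complex.exp_add]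
    simp only [schroedingerPhase, ContinuousMap.coe_mk, Circle.coe_exp]
    congr 2
    push_cast
    ring
  · simp only [LinearIsometryEquiv.coe_ofSurjective]
    exact weightedTranslation_comp (schroedingerPhase_mul lam mu p q) rfl φ
end

section
/- For all n ∈ ℕ and all v₁, v₂ ∈ ℝ, the Fourier–Wigner-type integral of Hermite functions satisfies ∫_ℝ e^{2 i v₁ t} h_n(t + v₂) h_n(t - v₂) dt = e^{-(v₁² + v₂²)} L_n^{(0)}(2(v₁² + v₂²)). -/
/-- The `n`-th Hermite function
`h_n(t) = (-1)^n (n! 2^n √π)^{-1/2} e^{t²/2} (d/dt)^n e^{-t²}`. -/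
noncomputable def hermiteF (n : ℕ) (t : ℝ) : ℝ :=
  (-1 : ℝ) ^ n * (Real.sqrt (n.factorial * 2 ^ n * Real.sqrt Real.pi))⁻¹ *
    Real.exp (t ^ 2 / 2) * iteratedDeriv n (fun s : ℝ => Real.exp (-s ^ 2)) t

open Polynomial MeasureTheory

/-- The physicists' Hermite polynomials, over an arbitrary commutative ring. -/
noncomputable def physHermite (R : Type*) [CommRing R] : ℕ → R[X]
  | 0 => 1
  | n + 1 => 2 * X * physHermite R n - derivative (physHermite R n)

theorem derivative_physHermite (R : Type*) [CommRing R] (n : ℕ) :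
    derivative (physHermite R n) = C (2 * n : R) * physHermite R (n - 1) := by
  induction n with
  | zero => simp [physHermite]
  | succ n ih =>
    rw [physHermite]
    simp only [derivative_sub, derivative_mul, derivative_X, derivative_ofNat]
    conv_lhs => enter [2]; rw [ih]
    rw [derivative_C_mul, ih]
    cases n with
    | zero => simp [physHermite, C_ofNat]
    | succ n =>
      simp only [Nat.add_sub_cancel, physHermite, map_mul, map_natCast, Nat.cast_add, map_add,
        Nat.cast_one, map_one, C_ofNat]
      ring

theorem map_physHermite {R S : Type*} [CommRing R] [CommRing S] (f : R →+* S) (n : ℕ) :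
    (physHermite R n).map f = physHermite S n := by
  induction n with
  | zero => simp [physHermite]
  | succ n ih => simp [physHermite, ← ih, derivative_map]

theorem iterate_derivative_physHermite_comp {R : Type*} [CommRing R] (n k : ℕ) (b : R) :
    derivative^[k] ((physHermite R n).comp (X + C b)) =
      C (2 ^ k * n.descFactorial k : R) * (physHermite R (n - k)).comp (X + C b) := by
  induction k with
  | zero => simp
  | succ k ih =>
    rw [Function.iterate_succ_apply', ih, derivative_C_mul, derivative_comp,
      derivative_physHermite, mul_comp, C_comp, Nat.descFactorial_succ, Nat.sub_sub]
    simp only [derivative_add, derivative_X, derivative_C, add_zero, one_mul, ← mul_assoc, ← C_mul]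
    congr 2
    push_cast
    ring

theorem iteratedDeriv_exp_neg_sq (n : ℕ) (t : ℝ) :
    iteratedDeriv n (fun s : ℝ => Real.exp (-s ^ 2)) t =
      (-1) ^ n * (physHermite ℝ n).eval t * Real.exp (-t ^ 2) := by
  induction n generalizing t with
  | zero => simp [physHermite]
  | succ n ih =>
    rw [iteratedDeriv_succ, funext ih]
    have hexp : HasDerivAt (fun s : ℝ => Real.exp (-s ^ 2)) (Real.exp (-t ^ 2) * -(2 * t)) t := by
      simpa using ((hasDerivAt_pow 2 t).neg).exp
    have h := (((physHermite ℝ n).hasDerivAt t).const_mul ((-1 : ℝ) ^ n)).mul hexp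
    refine h.deriv.trans ?_
    simp [physHermite]
    ring

section Functional

variable {R : Type*} [CommRing R] (ℓ : R[X] →ₗ[R] R) (c : R)

/-- If `ℓ` satisfies the integration by parts rule `ℓ ((2X - c) p) = ℓ p'`, then multiplication by a
shifted Hermite polynomial acts under `ℓ` as a power of `D + z`. -/
theorem apply_physHermite_comp_mul (hℓ : ∀ p, ℓ ((2 * X - C c) * p) = ℓ (derivative p))
    (a : R) (m : ℕ) (p : R[X]) :
    ℓ ((physHermite R m).comp (X + C a) * p) =
      ℓ (((derivative + (2 * a + c) • 1 : Module.End R R[X]) ^ m) p) := by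
  induction m generalizing p with
  | zero => simp [physHermite]
  | succ m ih =>
    rw [pow_succ, Module.End.mul_apply, ← ih]
    have h := hℓ ((physHermite R m).comp (X + C a) * p)
    simp only [derivative_mul, derivative_comp, derivative_add, derivative_X, derivative_C,
      add_zero, one_mul] at h
    have h2 : (physHermite R (m + 1)).comp (X + C a) * p =
        (2 * X - C c) * ((physHermite R m).comp (X + C a) * p)
          + C (2 * a + c) * ((physHermite R m).comp (X + C a) * p)
          - (derivative (physHermite R m)).comp (X + C a) * p := by
      simp only [physHermite, sub_comp, mul_comp, X_comp, ofNat_comp, C_add, C_mul, C_ofNat]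
      ring
    have h3 : (physHermite R m).comp (X + C a) *
        ((derivative + (2 * a + c) • 1 : Module.End R R[X]) p) =
        (physHermite R m).comp (X + C a) * derivative p
          + C (2 * a + c) * ((physHermite R m).comp (X + C a) * p) := by
      simp only [LinearMap.add_apply, LinearMap.smul_apply, Module.End.one_apply, smul_eq_C_mul]
      ring
    rw [h2, h3, map_sub, map_add, h, map_add ℓ, map_add ℓ]
    ring

theorem apply_physHermite_comp (hℓ : ∀ p, ℓ ((2 * X - C c) * p) = ℓ (derivative p))
    (b : R) (m : ℕ) :
    ℓ ((physHermite R m).comp (X + C b)) = (2 * b + c) ^ m * ℓ 1 := by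
  have h := apply_physHermite_comp_mul ℓ c hℓ b m 1
  rw [mul_one] at h
  rw [h]
  clear h
  have key : ((derivative + (2 * b + c) • 1 : Module.End R R[X]) ^ m) 1 =
      ((2 * b + c) ^ m) • (1 : R[X]) := by
    induction m with
    | zero => simp
    | succ m ih =>
      rw [pow_succ', Module.End.mul_apply, ih]
      simp [smul_smul, pow_succ]
  rw [key, map_smul, smul_eq_mul]

theorem apply_physHermite_comp_mul_physHermite_comp
    (hℓ : ∀ p, ℓ ((2 * X - C c) * p) = ℓ (derivative p)) (a b : R) (n : ℕ) :
    ℓ ((physHermite R n).comp (X + C a) * (physHermite R n).comp (X + C b)) =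
      (∑ k ∈ Finset.range (n + 1), n.choose k * (2 ^ k * n.descFactorial k) *
        ((2 * a + c) * (2 * b + c)) ^ (n - k)) * ℓ 1 := by
  have hcomm : Commute (derivative : Module.End R R[X]) ((2 * a + c) • 1) :=
    (Commute.one_right _).smul_right _
  rw [apply_physHermite_comp_mul ℓ c hℓ, hcomm.add_pow, LinearMap.sum_apply, map_sum,
    Finset.sum_mul]
  refine Finset.sum_congr rfl fun k _ => ?_
  have hk : ((derivative : Module.End R R[X]) ^ k * ((2 * a + c) • 1) ^ (n - k) *
      (n.choose k : Module.End R R[X])) ((physHermite R n).comp (X + C b)) =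
      ((2 * a + c) ^ (n - k) * n.choose k * (2 ^ k * n.descFactorial k)) •
        (physHermite R (n - k)).comp (X + C b) := by
    rw [_root_.smul_pow, one_pow, mul_smul_comm, mul_one, ← nsmul_eq_mul', LinearMap.smul_apply,
      LinearMap.smul_apply, Module.End.pow_apply, iterate_derivative_physHermite_comp,
      ← smul_eq_C_mul, ← Nat.cast_smul_eq_nsmul R, smul_smul, smul_smul]
    congr 1
    ring
  rw [hk, map_smul, smul_eq_mul, apply_physHermite_comp ℓ c hℓ, mul_pow]
  ring

end Functional

theorem integrable_eval_mul_cexp_neg_sq (c : ℝ) (p : ℂ[X]) :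
    Integrable fun t : ℝ => p.eval (t : ℂ) * Complex.exp (-t ^ 2 + Complex.I * c * t) := by
  induction p using Polynomial.induction_on' with
  | add p q hp hq =>
    simp only [eval_add, add_mul]
    exact hp.add hq
  | monomial n a =>
    have h := integrable_rpow_mul_exp_neg_mul_sq one_pos (s := n)
      (by linarith [n.cast_nonneg (α := ℝ)])
    refine (h.norm.const_mul ‖a‖).mono' (by fun_prop) (Filter.Eventually.of_forall fun t => ?_)
    have hre : (-(t : ℂ) ^ 2 + Complex.I * c * t).re = -1 * t ^ 2 := by
      simp [← Complex.ofReal_pow]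
    rw [norm_mul, Complex.norm_exp, hre]
    simp [mul_assoc]

/-- Integration of complex polynomials against `e^{-t² + ict}`. -/
noncomputable def gaussianFunctional (c : ℝ) : ℂ[X] →ₗ[ℂ] ℂ where
  toFun p := ∫ t : ℝ, p.eval (t : ℂ) * Complex.exp (-t ^ 2 + Complex.I * c * t)
  map_add' p q := by
    simp only [eval_add, add_mul]
    exact integral_add (integrable_eval_mul_cexp_neg_sq c p) (integrable_eval_mul_cexp_neg_sq c q)
  map_smul' a p := by
    simp only [eval_smul, smul_eq_mul, mul_assoc, RingHom.id_apply]
    exact integral_const_mul _ _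

theorem gaussianFunctional_apply (c : ℝ) (p : ℂ[X]) : gaussianFunctional c p =
    ∫ t : ℝ, p.eval (t : ℂ) * Complex.exp (-t ^ 2 + Complex.I * c * t) := rfl

theorem gaussianFunctional_two_mul_X_sub_mul (c : ℝ) (p : ℂ[X]) :
    gaussianFunctional c ((2 * X - C (Complex.I * c)) * p) =
      gaussianFunctional c (derivative p) := by
  rw [← sub_eq_zero, ← neg_eq_zero, neg_sub, ← map_sub, gaussianFunctional_apply]
  refine integral_eq_zero_of_hasDerivAt_of_integrable (fun t => ?_)
    (integrable_eval_mul_cexp_neg_sq c _) (integrable_eval_mul_cexp_neg_sq c p)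
  have h1 : HasDerivAt (fun z : ℂ => -z ^ 2 + Complex.I * c * z) (-(2 * t) + Complex.I * c)
      (t : ℂ) := by
    refine (((hasDerivAt_pow 2 (t : ℂ)).neg).add
      ((hasDerivAt_id (t : ℂ)).const_mul (Complex.I * c))).congr_deriv ?_
    simp
  have h := ((p.hasDerivAt (t : ℂ)).mul h1.cexp).comp_ofReal
  refine h.congr_deriv ?_
  simp
  ring

theorem gaussianFunctional_one (c : ℝ) :
    gaussianFunctional c 1 = ((√Real.pi * Real.exp (-(c / 2) ^ 2) : ℝ) : ℂ) := by
  have h := integral_cexp_quadratic (b := -1) (by simp) (Complex.I * c) 0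
  rw [gaussianFunctional_apply]
  simp only [eval_one, one_mul]
  simp only [neg_one_mul, add_zero, neg_neg, div_one, zero_sub] at h
  rw [h, Complex.ofReal_mul, Complex.ofReal_exp, Real.sqrt_eq_rpow,
    Complex.ofReal_cpow Real.pi_pos.le]
  congr 2
  · push_cast; rfl
  · rw [mul_pow, Complex.I_sq]
    push_cast
    ring

theorem hermiteF_eq (n : ℕ) (t : ℝ) :
    hermiteF n t = (√(n.factorial * 2 ^ n * √Real.pi))⁻¹ *
      ((physHermite ℝ n).eval t * Real.exp (-t ^ 2 / 2)) := by
  have h1 : ((-1 : ℝ) ^ n) * (-1) ^ n = 1 := by rw [← mul_pow]; simp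
  have h2 : Real.exp (-t ^ 2 / 2) = Real.exp (t ^ 2 / 2) * Real.exp (-t ^ 2) := by
    rw [← Real.exp_add]; ring_nf
  rw [hermiteF, iteratedDeriv_exp_neg_sq, h2]
  linear_combination ((√(n.factorial * 2 ^ n * √Real.pi))⁻¹ *
    ((physHermite ℝ n).eval t * (Real.exp (t ^ 2 / 2) * Real.exp (-t ^ 2)))) * h1

theorem lagP_zero_eq_sum (n : ℕ) (u : ℝ) :
    lagP n 0 u = (n.factorial : ℝ)⁻¹ *
      ∑ k ∈ Finset.range (n + 1), n.choose k * n.descFactorial k * (-u) ^ (n - k) := by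
  have hexp (k : ℕ) : iteratedDeriv k (fun v : ℝ => Real.exp (-v)) u = (-1) ^ k * Real.exp (-u) := by
    simpa using congrFun (iteratedDeriv_exp_const_mul k (-1)) u
  rw [lagP, iteratedDeriv_fun_mul (by fun_prop) (by fun_prop), Finset.mul_sum, Finset.mul_sum]
  refine Finset.sum_congr rfl fun k _ => ?_
  rw [hexp, zero_add, iteratedDeriv_pow, neg_pow u, pow_zero, mul_one, Real.exp_neg]
  field_simp

/-- The Fourier–Wigner-type integral of Hermite functions:
`∫ e^{2iv₁t} h_n(t+v₂) h_n(t-v₂) dt = e^{-(v₁²+v₂²)} L_n^{(0)}(2(v₁²+v₂²))`. -/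
theorem fourier_wigner_hermite (n : ℕ) (v₁ v₂ : ℝ) :
    ∫ t : ℝ, Complex.exp (2 * Complex.I * v₁ * t)
        * (hermiteF n (t + v₂) : ℂ) * (hermiteF n (t - v₂) : ℂ)
      = ((Real.exp (-(v₁ ^ 2 + v₂ ^ 2)) * lagP n 0 (2 * (v₁ ^ 2 + v₂ ^ 2)) : ℝ) : ℂ) := by
  have hcast (t : ℝ) : (((physHermite ℝ n).eval t : ℝ) : ℂ) = (physHermite ℂ n).eval (t : ℂ) := by
    rw [← map_physHermite Complex.ofRealHom n]
    exact (eval_map_apply Complex.ofRealHom t).symm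
  have hnorm : (√(n.factorial * 2 ^ n * √Real.pi))⁻¹ * (√(n.factorial * 2 ^ n * √Real.pi))⁻¹ =
      (n.factorial * 2 ^ n * √Real.pi)⁻¹ := by
    rw [← mul_inv, Real.mul_self_sqrt (by positivity)]
  have hexp (t : ℝ) : Real.exp (-(t + v₂) ^ 2 / 2) * Real.exp (-(t - v₂) ^ 2 / 2) =
      Real.exp (-v₂ ^ 2) * Real.exp (-t ^ 2) := by
    rw [← Real.exp_add, ← Real.exp_add]; ring_nf
  have hint (t : ℝ) : Complex.exp (2 * Complex.I * v₁ * t)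
        * (hermiteF n (t + v₂) : ℂ) * (hermiteF n (t - v₂) : ℂ) =
      (((n.factorial * 2 ^ n * √Real.pi)⁻¹ * Real.exp (-v₂ ^ 2) : ℝ) : ℂ) *
        (((physHermite ℂ n).comp (X + C (v₂ : ℂ)) *
          (physHermite ℂ n).comp (X + C (-v₂ : ℂ))).eval (t : ℂ) *
          Complex.exp (-t ^ 2 + Complex.I * (2 * v₁ : ℝ) * t)) := by
    have hsplit : Complex.exp (-t ^ 2 + Complex.I * (2 * v₁ : ℝ) * t) =
        (Real.exp (-t ^ 2) : ℂ) * Complex.exp (2 * Complex.I * v₁ * t) := by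
      rw [Complex.ofReal_exp, ← Complex.exp_add]
      push_cast
      ring_nf
    have hprod : hermiteF n (t + v₂) * hermiteF n (t - v₂) =
        ((n.factorial * 2 ^ n * √Real.pi)⁻¹ * Real.exp (-v₂ ^ 2)) *
          ((physHermite ℝ n).eval (t + v₂) * (physHermite ℝ n).eval (t - v₂)) *
          Real.exp (-t ^ 2) := by
      rw [hermiteF_eq, hermiteF_eq, ← hnorm]
      linear_combination ((√(n.factorial * 2 ^ n * √Real.pi))⁻¹ *
        (√(n.factorial * 2 ^ n * √Real.pi))⁻¹ *
        ((physHermite ℝ n).eval (t + v₂) * (physHermite ℝ n).eval (t - v₂))) * hexp t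
    rw [mul_assoc, ← Complex.ofReal_mul, hprod, hsplit, Complex.ofReal_mul, Complex.ofReal_mul,
      Complex.ofReal_mul ((physHermite ℝ n).eval _), hcast, hcast]
    simp only [eval_mul, eval_comp, eval_add, eval_X, eval_C, Complex.ofReal_add,
      Complex.ofReal_sub, ← sub_eq_add_neg]
    ring
  simp_rw [hint]
  rw [integral_const_mul, ← gaussianFunctional_apply,
    apply_physHermite_comp_mul_physHermite_comp _ _
      (gaussianFunctional_two_mul_X_sub_mul (2 * v₁)), gaussianFunctional_one]
  have hzw : (2 * (v₂ : ℂ) + Complex.I * (2 * v₁ : ℝ)) * (2 * -v₂ + Complex.I * (2 * v₁ : ℝ)) =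
      ((2 * -(2 * (v₁ ^ 2 + v₂ ^ 2)) : ℝ) : ℂ) := by
    push_cast
    linear_combination (4 * (v₁ : ℂ) ^ 2) * Complex.I_sq
  rw [hzw]
  norm_cast
  have hsum : ∑ k ∈ Finset.range (n + 1), (n.choose k : ℝ) * (2 ^ k * n.descFactorial k) *
        (2 * -(2 * (v₁ ^ 2 + v₂ ^ 2))) ^ (n - k) =
      2 ^ n * ∑ k ∈ Finset.range (n + 1), (n.choose k : ℝ) * n.descFactorial k *
        (-(2 * (v₁ ^ 2 + v₂ ^ 2))) ^ (n - k) := by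
    rw [Finset.mul_sum]
    refine Finset.sum_congr rfl fun k hk => ?_
    have h2 : (2 : ℝ) ^ n = 2 ^ k * 2 ^ (n - k) := by
      rw [← pow_add, Nat.add_sub_of_le (Finset.mem_range_succ_iff.mp hk)]
    rw [mul_pow, h2]
    ring
  have hE : Real.exp (-(v₁ ^ 2 + v₂ ^ 2)) = Real.exp (-v₂ ^ 2) * Real.exp (-v₁ ^ 2) := by
    rw [← Real.exp_add]; ring_nf
  have hpi : √Real.pi ≠ 0 := (Real.sqrt_pos.mpr Real.pi_pos).ne'
  push_cast
  rw [hsum, lagP_zero_eq_sum, hE, mul_div_cancel_left₀ v₁ two_ne_zero]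
  field_simp
end

section
/- For every real a ≥ 0 there is a constant C_a > 0 such that for all real s ≥ 0, ρ > 0 and M > 0, Σ_{(n,j)∈ℕ×ℕ} (2(n+2j+s)+1)^{a-1} · 1_{[1/2,2]}(ρ / ((2(n+2j+s)+1) M)) ≤ C_a (ρ/M)^{a+1}, where 1_{[1/2,2]} is the characteristic function of the interval [1/2, 2]. -/
theorem rpow_le_two_rpow_abs {y : ℝ} (b : ℝ) (h₁ : 1 / 2 ≤ y) (h₂ : y ≤ 2) :
    y ^ b ≤ (2 : ℝ) ^ |b| := by
  rcases le_total 0 b with hb | hb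
  · rw [abs_of_nonneg hb]
    exact Real.rpow_le_rpow (by linarith) h₂ hb
  · rw [abs_of_nonpos hb, Real.rpow_neg (by norm_num), ← Real.inv_rpow (by norm_num)]
    exact Real.rpow_le_rpow_of_nonpos (by norm_num) (by linarith) hb

theorem rpow_le_two_rpow_abs_mul_rpow {x T : ℝ} (b : ℝ) (hT : 0 < T) (h₁ : T / 2 ≤ x)
    (h₂ : x ≤ 2 * T) : x ^ b ≤ (2 : ℝ) ^ |b| * T ^ b := by
  have hx : x = x / T * T := by field_simp
  have hy₁ : 1 / 2 ≤ x / T := by rw [le_div_iff₀ hT]; linarith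
  have hy₂ : x / T ≤ 2 := by rw [div_le_iff₀ hT]; linarith
  rw [hx, Real.mul_rpow (by linarith) hT.le]
  exact mul_le_mul_of_nonneg_right (rpow_le_two_rpow_abs b hy₁ hy₂) (Real.rpow_nonneg hT.le b)

theorem bounds_of_div_mul_mem_Icc {x ρ M : ℝ} (hx : 0 < x)
    (h : ρ / (x * M) ∈ Set.Icc (1 / 2 : ℝ) 2) : ρ / M / 2 ≤ x ∧ x ≤ 2 * (ρ / M) := by
  obtain ⟨h₁, h₂⟩ := h
  rw [mul_comm, ← div_div] at h₁ h₂
  rw [le_div_iff₀ hx] at h₁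
  rw [div_le_iff₀ hx] at h₂
  constructor <;> linarith

/-- For every `a ≥ 0` there is `C_a > 0` with
`Σ_{(n,j)} (2(n+2j+s)+1)^{a-1} 1_{[1/2,2]}(ρ/((2(n+2j+s)+1)M)) ≤ C_a (ρ/M)^{a+1}`
for all `s ≥ 0`, `ρ > 0`, `M > 0`. -/
theorem double_sum_dyadic_bound (a : ℝ) (ha : 0 ≤ a) :
    ∃ C > 0, ∀ s ρ M : ℝ, 0 ≤ s → 0 < ρ → 0 < M →
      ∑' p : ℕ × ℕ, (2 * (p.1 + 2 * p.2 + s) + 1) ^ (a - 1)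
          * Set.indicator (Set.Icc (1 / 2 : ℝ) 2) (fun _ => (1 : ℝ))
              (ρ / ((2 * (p.1 + 2 * p.2 + s) + 1) * M))
        ≤ C * (ρ / M) ^ (a + 1) := by
  refine ⟨9 * 2 ^ |a - 1|, by positivity, fun s ρ M hs hρ hM => ?_⟩
  have hT : 0 < ρ / M := div_pos hρ hM
  have hbounds (p : ℕ × ℕ)
      (h : ρ / ((2 * (p.1 + 2 * p.2 + s) + 1) * M) ∈ Set.Icc (1 / 2 : ℝ) 2) :=
    bounds_of_div_mul_mem_Icc (by positivity) h
  generalize hTdef : ρ / M = T at *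
  rcases lt_or_ge T (1 / 2) with hsmall | hlarge
  · have hzero (p : ℕ × ℕ) : (2 * (p.1 + 2 * p.2 + s) + 1) ^ (a - 1)
          * Set.indicator (Set.Icc (1 / 2 : ℝ) 2) (fun _ => (1 : ℝ))
              (ρ / ((2 * (p.1 + 2 * p.2 + s) + 1) * M)) = 0 := by
      rw [Set.indicator_of_notMem, mul_zero]
      intro h
      have h₂ := (hbounds p h).2
      have : (0 : ℝ) ≤ p.1 := by positivity
      have : (0 : ℝ) ≤ p.2 := by positivity
      linarith
    simp_rw [hzero, tsum_zero]
    positivity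
  · set N := ⌊T⌋₊ + 1 with hN
    have hNT : (N : ℝ) ≤ 3 * T := by
      have := Nat.floor_le hT.le
      push_cast [hN]
      linarith
    rw [tsum_eq_sum (s := Finset.range N ×ˢ Finset.range N)]
    · calc _ ≤ (Finset.range N ×ˢ Finset.range N).card • (2 ^ |a - 1| * T ^ (a - 1)) := by
            refine Finset.sum_le_card_nsmul _ _ _ fun p _ => ?_
            by_cases h : ρ / ((2 * (p.1 + 2 * p.2 + s) + 1) * M) ∈ Set.Icc (1 / 2 : ℝ) 2
            · rw [Set.indicator_of_mem h, mul_one]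
              exact rpow_le_two_rpow_abs_mul_rpow _ hT (hbounds p h).1 (hbounds p h).2
            · rw [Set.indicator_of_notMem h, mul_zero]
              positivity
        _ = (N : ℝ) ^ 2 * (2 ^ |a - 1| * T ^ (a - 1)) := by
            simp [sq]
        _ ≤ (3 * T) ^ 2 * (2 ^ |a - 1| * T ^ (a - 1)) := by gcongr
        _ = 9 * 2 ^ |a - 1| * T ^ (a + 1) := by
            have : T ^ (a + 1) = T ^ (a - 1) * T ^ 2 := by
              rw [← Real.rpow_natCast, ← Real.rpow_add hT]
              congr 1
              push_cast
              ring
            rw [this]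
            ring
    · intro p hp
      rw [Set.indicator_of_notMem, mul_zero]
      intro h
      apply hp
      have h₂ := (hbounds p h).2
      have h₃ : (0 : ℝ) ≤ p.1 := by positivity
      have h₄ : (0 : ℝ) ≤ p.2 := by positivity
      rw [Finset.mem_product, Finset.mem_range, Finset.mem_range, hN, Nat.lt_succ_iff,
        Nat.lt_succ_iff]
      exact ⟨Nat.le_floor (by linarith), Nat.le_floor (by linarith)⟩
end
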